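/- Probability concentration of the Fejér kernel: with the setup above, the probability of measuring z = y + ⌊k⌋ or z = y + ⌊k⌋ + 1 (mod 2^d) is at least 8/π², i.e., |⟨y+⌊k⌋|QFT_d† P_d(k) QFT_d|y⟩|² + |⟨y+⌊k⌋+1|QFT_d† P_d(k) QFT_d|y⟩|² ≥ 8/π². -/

import Mathlib

open Complex in
lemma aux_half (t : ℝ) (h0 : 0 < t) (h1 : t ≤ 1 / 2) :
    8 * (t ^ 2 * (1 - t) ^ 2) ≤ Real.sin (Real.pi * t) ^ 2 * (t ^ 2 + (1 - t) ^ 2) := by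
  have hp1 := Real.pi_gt_d2
  have hp2 := Real.pi_lt_d4
  have hpp : Real.pi ^ 2 ≤ 9.9 := by nlinarith
  rcases le_total t (1 / 5) with h | h
  · have hs := Real.sin_gt_sub_cube (x := Real.pi * t) (by positivity)
    have hL : 3.14 * t * (1 - 2.48 * t ^ 2) ≤ Real.sin (Real.pi * t) := by
      have e : Real.pi * t - (Real.pi * t) ^ 3 / 6 = Real.pi * t * (1 - Real.pi ^ 2 * t ^ 2 / 6) := by
        ring
      rw [e] at hs
      refine le_trans ?_ hs.le
      have : Real.pi ^ 2 * t ^ 2 ≤ 9.9 * t ^ 2 := by gcongr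
      apply mul_le_mul
      · gcongr
      · linarith [sq_nonneg t]
      · nlinarith
      · positivity
    have hL0 : 0 ≤ 3.14 * t * (1 - 2.48 * t ^ 2) := by
      apply mul_nonneg (by positivity); nlinarith
    have hsq := pow_le_pow_left₀ hL0 hL 2
    refine le_trans ?_ (mul_le_mul_of_nonneg_right hsq (by positivity))
    have key : 8 * (1 - t) ^ 2 ≤ 9.85 * (1 - 4.96 * t ^ 2) * (t ^ 2 + (1 - t) ^ 2) := by
      nlinarith [mul_nonneg h0.le (sub_nonneg.2 h), mul_nonneg (mul_nonneg h0.le h0.le) (sub_nonneg.2 h), mul_nonneg (mul_nonneg h0.le h0.le) (mul_nonneg h0.le (sub_nonneg.2 h))]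
    have k2 : 9.85 * (1 - 4.96 * t ^ 2) * (t ^ 2 + (1 - t) ^ 2) ≤
        (3.14 * (1 - 2.48 * t ^ 2)) ^ 2 * (t ^ 2 + (1 - t) ^ 2) := by
      gcongr
      nlinarith [sq_nonneg (t ^ 2), sq_nonneg (1 - 2.48 * t ^ 2)]
    have := mul_le_mul_of_nonneg_left (key.trans k2) (sq_nonneg t)
    nlinarith
  · obtain ⟨s, rfl⟩ : ∃ s, t = 1 / 2 - s := ⟨1 / 2 - t, by ring⟩
    have hc : Real.sin (Real.pi * (1 / 2 - s)) = Real.cos (Real.pi * s) := by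
      rw [← Real.sin_pi_div_two_sub]; ring_nf
    rw [hc]
    have hs := Real.one_sub_sq_div_two_le_cos (x := Real.pi * s)
    have hq : s ^ 2 ≤ 0.09 := by nlinarith
    have hL : 1 - 4.95 * s ^ 2 ≤ Real.cos (Real.pi * s) := by
      have : Real.pi ^ 2 * s ^ 2 ≤ 9.9 * s ^ 2 := by gcongr
      rw [mul_pow] at hs
      linarith
    have hsq := pow_le_pow_left₀ (by linarith) hL 2
    refine le_trans ?_ (mul_le_mul_of_nonneg_right hsq (by positivity))
    have e1 : (1 / 2 - s) ^ 2 * (1 - (1 / 2 - s)) ^ 2 = (1 / 4 - s ^ 2) ^ 2 := by ring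
    have e2 : (1 / 2 - s) ^ 2 + (1 - (1 / 2 - s)) ^ 2 = 1 / 2 + 2 * s ^ 2 := by ring
    rw [e1, e2]
    have hq0 := sq_nonneg s
    generalize s ^ 2 = q at hq hq0
    have : 0 ≤ q * (1.05 - 15.56 * q + 49 * q ^ 2) := by
      apply mul_nonneg hq0
      nlinarith [mul_nonneg (sub_nonneg.2 hq) (sub_nonneg.2 hq)]
    nlinarith [pow_nonneg hq0 3]

lemma aux_full (t : ℝ) (h0 : 0 < t) (h1 : t < 1) :
    8 / Real.pi ^ 2 ≤ (Real.sin (Real.pi * t) / (Real.pi * t)) ^ 2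
      + (Real.sin (Real.pi * (t - 1)) / (Real.pi * (t - 1))) ^ 2 := by
  have h : 8 * (t ^ 2 * (1 - t) ^ 2) ≤ Real.sin (Real.pi * t) ^ 2 * (t ^ 2 + (1 - t) ^ 2) := by
    rcases le_total t (1 / 2) with h | h
    · exact aux_half t h0 h
    · have := aux_half (1 - t) (by linarith) (by linarith)
      have e : Real.sin (Real.pi * (1 - t)) = Real.sin (Real.pi * t) := by
        rw [← Real.sin_pi_sub]; ring_nf
      rw [e] at this
      nlinarith
  have e : Real.sin (Real.pi * (t - 1)) = - Real.sin (Real.pi * t) := by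
    rw [← Real.sin_sub_pi]; ring_nf
  rw [e]
  have hp := Real.pi_pos
  have ht : 1 - t ≠ 0 := by linarith
  have e2 : (Real.sin (Real.pi * t) / (Real.pi * t)) ^ 2
      + (-Real.sin (Real.pi * t) / (Real.pi * (t - 1))) ^ 2
      = (Real.sin (Real.pi * t) ^ 2 * (t ^ 2 + (1 - t) ^ 2) / (t ^ 2 * (1 - t) ^ 2)) / Real.pi ^ 2 := by
    have : t - 1 = -(1 - t) := by ring
    rw [this]
    field_simp
    ring
  rw [e2]
  gcongr
  rw [le_div_iff₀ (by have : 0 < 1 - t := by linarith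
                      positivity)]
  exact h

open Complex in
lemma aux_geom (N : ℕ) (hN : 0 < N) (t : ℝ) (ht : t ≠ 0) :
    (Real.sin (Real.pi * t) / (Real.pi * t)) ^ 2 ≤
      ‖(1 / (N : ℂ)) * ∑ j ∈ Finset.range N, Complex.exp (2 * Real.pi * I * t * j / N)‖ ^ 2 := by
  have hNR : (0 : ℝ) < N := by exact_mod_cast hN
  have hNC : (N : ℂ) ≠ 0 := by exact_mod_cast hN.ne'
  have hp := Real.pi_pos
  set q : ℂ := Complex.exp (I * ((2 * Real.pi * t / N : ℝ) : ℂ)) with hq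
  have hS : ∑ j ∈ Finset.range N, Complex.exp (2 * Real.pi * I * t * j / N)
      = ∑ j ∈ Finset.range N, q ^ j := by
    refine Finset.sum_congr rfl fun j _ => ?_
    rw [hq, ← Complex.exp_nat_mul]
    congr 1; push_cast; ring
  rw [hS]
  have hg := geom_sum_mul q N
  have hqN : q ^ N = Complex.exp (I * ((2 * Real.pi * t : ℝ) : ℂ)) := by
    rw [hq, ← Complex.exp_nat_mul]
    congr 1; push_cast; field_simp
  rw [hqN] at hg
  have hn := congrArg norm hg
  rw [norm_mul, Complex.norm_exp_I_mul_ofReal_sub_one (2 * Real.pi * t)] at hn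
  have hle : ‖q - 1‖ ≤ ‖2 * Real.pi * t / N‖ := Real.norm_exp_I_mul_ofReal_sub_one_le
  set S := ∑ j ∈ Finset.range N, q ^ j
  have h1 := mul_le_mul_of_nonneg_left hle (norm_nonneg S)
  rw [hn] at h1
  have e : 2 * Real.pi * t / 2 = Real.pi * t := by ring
  rw [e] at h1
  simp only [Real.norm_eq_abs, abs_mul, abs_div, abs_of_pos hp, abs_of_pos hNR, abs_two] at h1
  rw [← sq_abs]
  gcongr
  have hta : 0 < |t| := abs_pos.2 ht
  rw [abs_div, abs_mul, abs_of_pos hp, norm_mul, norm_div, norm_one, Complex.norm_natCast,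
    div_le_iff₀ (by positivity)]
  have : ‖S‖ * (2 * Real.pi * |t| / N) = 2 * (1 / N * ‖S‖ * (Real.pi * |t|)) := by ring
  linarith

open Complex in
lemma aux_entry (N : ℕ) [NeZero N] (k : ℝ)
    (F P : Matrix (ZMod N) (ZMod N) ℂ)
    (hF : ∀ z y : ZMod N,
      F z y = (1 / Real.sqrt N : ℝ) *
        Complex.exp (2 * Real.pi * I * (z.val : ℂ) * (y.val : ℂ) / N))
    (hP : P = Matrix.diagonal fun w : ZMod N =>
      Complex.exp (2 * Real.pi * I * (k : ℂ) * (w.val : ℂ) / N))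
    (y z : ZMod N) (n : ℤ) (hz : z = y + n) :
    (F.conjTranspose * P * F) z y =
      (1 / (N : ℂ)) * ∑ j ∈ Finset.range N,
        Complex.exp (2 * Real.pi * I * ((k - n : ℝ) : ℂ) * j / N) := by
  have hNC : (N : ℂ) ≠ 0 := by exact_mod_cast NeZero.ne N
  obtain ⟨m, hm⟩ : ∃ m : ℤ, (y.val : ℤ) + n - z.val = N * m := by
    have : (((y.val : ℤ) + n - z.val : ℤ) : ZMod N) = 0 := by
      push_cast
      simp [hz]
    exact (ZMod.intCast_zmod_eq_zero_iff_dvd _ N).1 this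
  have hmC : (y.val : ℂ) - z.val = N * m - n := by
    have : ((y.val : ℤ) + n - z.val : ℂ) = N * m := by exact_mod_cast congrArg (Int.cast : ℤ → ℂ) hm
    push_cast at this
    linear_combination this
  rw [hP, Matrix.mul_apply, Finset.mul_sum]
  have hsum : ∀ f : ℕ → ℂ, ∑ j ∈ Finset.range N, f j = ∑ w : ZMod N, f w.val := by
    intro f
    symm
    refine Finset.sum_bij (fun w _ => w.val) ?_ ?_ ?_ ?_
    · intro w _; simpa using ZMod.val_lt w
    · intro a _ b _ h; exact ZMod.val_injective N h
    · intro b hb; exact ⟨b, Finset.mem_univ _, ZMod.val_cast_of_lt (by simpa using hb)⟩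
    · intros; rfl
  rw [hsum]
  refine Finset.sum_congr rfl fun w _ => ?_
  rw [Matrix.mul_diagonal, Matrix.conjTranspose_apply, hF, hF, star_mul']
  have hc : star (Complex.exp (2 * Real.pi * I * (w.val : ℂ) * (z.val : ℂ) / N))
      = Complex.exp (-(2 * Real.pi * I * (w.val : ℂ) * (z.val : ℂ) / N)) := by
    rw [Complex.star_def, ← Complex.exp_conj]
    congr 1
    simp only [map_div₀, map_mul, Complex.conj_ofReal, Complex.conj_I, map_natCast, map_ofNat]
    ring
  have hr : star (((1 / Real.sqrt N : ℝ)) : ℂ) = ((1 / Real.sqrt N : ℝ) : ℂ) := by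
    rw [Complex.star_def, Complex.conj_ofReal]
  rw [hc, hr]
  have hs : ((1 / Real.sqrt N : ℝ) : ℂ) * ((1 / Real.sqrt N : ℝ) : ℂ) = 1 / N := by
    rw [← Complex.ofReal_mul, div_mul_div_comm, Real.mul_self_sqrt (Nat.cast_nonneg N)]
    push_cast; ring
  have he : Complex.exp (-(2 * Real.pi * I * (w.val : ℂ) * (z.val : ℂ) / N)) *
      Complex.exp (2 * Real.pi * I * (k : ℂ) * (w.val : ℂ) / N) *
      Complex.exp (2 * Real.pi * I * (w.val : ℂ) * (y.val : ℂ) / N) =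
      Complex.exp (2 * Real.pi * I * ((k - n : ℝ) : ℂ) * w.val / N) := by
    rw [← Complex.exp_add, ← Complex.exp_add, Complex.exp_eq_exp_iff_exists_int]
    refine ⟨w.val * m, ?_⟩
    push_cast
    field_simp
    linear_combination (w.val : ℂ) * hmC
  rw [← hs, ← he]
  ring

open Complex in
/-- Probability concentration of the Fejér kernel: measuring
`QFT_d† ∘ P_d(k) ∘ QFT_d |y⟩` yields `y + ⌊k⌋` or `y + ⌊k⌋ + 1 (mod 2^d)` with
probability at least `8/π²`. -/
theorem fejer_concentration (d : ℕ) (hd : 1 ≤ d) [NeZero (2 ^ d)] (k : ℝ)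
    (hk : ∀ m : ℤ, k ≠ m)
    (F P : Matrix (ZMod (2 ^ d)) (ZMod (2 ^ d)) ℂ)
    (hF : ∀ z y : ZMod (2 ^ d),
      F z y = (1 / Real.sqrt (2 ^ d) : ℝ) *
        Complex.exp (2 * Real.pi * I * (z.val : ℂ) * (y.val : ℂ) / 2 ^ d))
    (hP : P = Matrix.diagonal fun w : ZMod (2 ^ d) =>
      Complex.exp (2 * Real.pi * I * (k : ℂ) * (w.val : ℂ) / 2 ^ d))
    (y : ZMod (2 ^ d)) :
    ‖(F.conjTranspose * P * F) (y + (⌊k⌋ : ZMod (2 ^ d))) y‖ ^ 2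
      + ‖(F.conjTranspose * P * F) (y + (⌊k⌋ : ZMod (2 ^ d)) + 1) y‖ ^ 2
      ≥ 8 / Real.pi ^ 2 := by
  have hfl : (⌊k⌋ : ℝ) < k := lt_of_le_of_ne (Int.floor_le k) (hk ⌊k⌋).symm
  have hfu := Int.lt_floor_add_one k
  have hF' : ∀ z y : ZMod (2 ^ d),
      F z y = (1 / Real.sqrt ((2 ^ d : ℕ) : ℝ) : ℝ) *
        Complex.exp (2 * Real.pi * I * (z.val : ℂ) * (y.val : ℂ) / ((2 ^ d : ℕ) : ℂ)) := by
    intro z y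
    rw [hF]; push_cast; rfl
  have hP' : P = Matrix.diagonal fun w : ZMod (2 ^ d) =>
      Complex.exp (2 * Real.pi * I * (k : ℂ) * (w.val : ℂ) / ((2 ^ d : ℕ) : ℂ)) := by
    rw [hP]; push_cast; rfl
  have hN : 0 < 2 ^ d := by positivity
  rw [aux_entry (2 ^ d) k F P hF' hP' y _ ⌊k⌋ rfl,
    aux_entry (2 ^ d) k F P hF' hP' y (y + (⌊k⌋ : ZMod (2 ^ d)) + 1) (⌊k⌋ + 1)
      (by push_cast; ring)]
  have h1 := aux_geom (2 ^ d) hN (k - ⌊k⌋) (by linarith)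
  have h2 := aux_geom (2 ^ d) hN (k - (⌊k⌋ + 1 : ℤ)) (by push_cast; linarith)
  have h3 := aux_full (k - ⌊k⌋) (by linarith) (by linarith)
  have e : k - ((⌊k⌋ + 1 : ℤ) : ℝ) = k - ⌊k⌋ - 1 := by push_cast; ring
  rw [e] at h2 ⊢
  exact h3.trans (add_le_add h1 h2)
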